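/- Let u(z,t) = (4πit)^{-n/2} e^{i|z|^2/(4t)} F(z/(2t), 1/t) where F(Z,s) is smooth in (Z,s) near s=0. If (D_t + Δ_0)u = 0 for t > 0 (with Δ_0 the positive flat Laplacian on ℝ^n and D_t = -i∂_t), then the full Taylor series of F in s at s = 0 is determined by F(·, 0). In particular two such solutions whose asymptotic data F(·,0) coincide differ by O(s^∞) in F. -/

import Mathlib

open scoped RealInnerProductSpace

noncomputable section

/-- The positive flat Laplacian `Δ₀ = -∑_j ∂_{z_j}²` applied pointwise. -/
def posLap {n : ℕ} (f : EuclideanSpace ℝ (Fin n) → ℂ) (z : EuclideanSpace ℝ (Fin n)) : ℂ :=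
  -∑ j : Fin n,
    fderiv ℝ (fun w => fderiv ℝ f w (EuclideanSpace.single j (1 : ℝ))) z
      (EuclideanSpace.single j (1 : ℝ))

abbrev EE (n : ℕ) := EuclideanSpace ℝ (Fin n)

/-- directional derivative -/
def dd {n : ℕ} (v : EE n × ℝ) (G : EE n × ℝ → ℂ) : EE n × ℝ → ℂ := fun p => fderiv ℝ G p v

def ej {n : ℕ} (j : Fin n) : EE n × ℝ := (EuclideanSpace.single j (1 : ℝ), 0)

def es {n : ℕ} : EE n × ℝ := (0, 1)

lemma dd_smooth {n : ℕ} (v : EE n × ℝ) {G : EE n × ℝ → ℂ} (h : ContDiff ℝ (⊤ : ℕ∞) G) :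
    ContDiff ℝ (⊤ : ℕ∞) (dd v G) := by
  unfold dd
  exact (h.fderiv_right (m := (⊤ : ℕ∞)) (by simp)).clm_apply contDiff_const

lemma smooth_diff {n : ℕ} {G : EE n × ℝ → ℂ} (h : ContDiff ℝ (⊤ : ℕ∞) G) :
    Differentiable ℝ G := h.differentiable (by simp)

lemma dd_comm {n : ℕ} (v w : EE n × ℝ) {G : EE n × ℝ → ℂ} (h : ContDiff ℝ (⊤ : ℕ∞) G) :
    dd v (dd w G) = dd w (dd v G) := by
  funext p
  have hd : DifferentiableAt ℝ (fderiv ℝ G) p :=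
    ((h.fderiv_right (m := (⊤ : ℕ∞)) (by simp)).differentiable (by simp)) p
  have key : ∀ a b : EE n × ℝ, dd a (dd b G) p = fderiv ℝ (fderiv ℝ G) p a b := by
    intro a b
    unfold dd
    rw [fderiv_clm_apply hd (differentiableAt_const b)]
    simp
  rw [key, key]
  exact (h.contDiffAt.isSymmSndFDerivAt (by simpa using (by exact_mod_cast le_top : ((2 : ℕ∞) : WithTop ℕ∞) ≤ ((⊤ : ℕ∞) : WithTop ℕ∞)))).eq v w

def PDE {n : ℕ} (G : EE n × ℝ → ℂ) : Prop :=
  ∀ p : EE n × ℝ, 0 < p.2 → dd es G p = (-Complex.I / 4) * ∑ j : Fin n, dd (ej j) (dd (ej j) G) p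

lemma PDE_closed {n : ℕ} {G : EE n × ℝ → ℂ} (h : ContDiff ℝ (⊤ : ℕ∞) G) (hp : PDE G)
    (Z : EE n) :
    dd es G (Z, 0) = (-Complex.I / 4) * ∑ j : Fin n, dd (ej j) (dd (ej j) G) (Z, 0) := by
  have h1 : Continuous (fun s : ℝ => dd es G (Z, s)) :=
    (dd_smooth es h).continuous.comp (by fun_prop)
  have h2 : Continuous (fun s : ℝ => (-Complex.I / 4) * ∑ j : Fin n, dd (ej j) (dd (ej j) G) (Z, s)) := by
    refine continuous_const.mul (continuous_finsetSum _ fun j _ => ?_)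
    exact (dd_smooth _ (dd_smooth (ej j) h)).continuous.comp (by fun_prop)
  have h3 : Set.EqOn (fun s : ℝ => dd es G (Z, s))
      (fun s : ℝ => (-Complex.I / 4) * ∑ j : Fin n, dd (ej j) (dd (ej j) G) (Z, s)) (Set.Ioi 0) :=
    fun s hs => hp (Z, s) hs
  have h4 := h3.closure h1 h2
  rw [closure_Ioi] at h4
  exact h4 (Set.self_mem_Ici)

lemma PDE_ds {n : ℕ} {G : EE n × ℝ → ℂ} (h : ContDiff ℝ (⊤ : ℕ∞) G) (hp : PDE G) :
    PDE (dd es G) := by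
  intro p hp0
  have ho : ∀ᶠ q in nhds p, dd es G q =
      (-Complex.I / 4) * ∑ j : Fin n, dd (ej j) (dd (ej j) G) q := by
    filter_upwards [(isOpen_lt continuous_const continuous_snd).mem_nhds hp0] with q hq
    exact hp q hq
  have hs : ∀ j : Fin n, DifferentiableAt ℝ (dd (ej j) (dd (ej j) G)) p := fun j =>
    smooth_diff (dd_smooth _ (dd_smooth (ej j) h)) p
  have : dd es (dd es G) p = dd es (fun q => (-Complex.I / 4) * ∑ j : Fin n, dd (ej j) (dd (ej j) G) q) p := by
    unfold dd at ho ⊢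
    rw [Filter.EventuallyEq.fderiv_eq ho]
  rw [this]
  have e2 : HasFDerivAt (fun q => (-Complex.I / 4) * ∑ j : Fin n, dd (ej j) (dd (ej j) G) q)
      ((-Complex.I / 4) • ∑ j : Fin n, fderiv ℝ (dd (ej j) (dd (ej j) G)) p) p :=
    (HasFDerivAt.fun_sum fun j _ => (hs j).hasFDerivAt).const_mul _
  have e3 : dd es (fun q => (-Complex.I / 4) * ∑ j : Fin n, dd (ej j) (dd (ej j) G) q) p
      = (-Complex.I / 4) * ∑ j : Fin n, dd es (dd (ej j) (dd (ej j) G)) p := by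
    unfold dd at e2 ⊢
    rw [e2.fderiv]
    simp
  rw [e3]
  congr 1
  refine Finset.sum_congr rfl fun j _ => ?_
  rw [dd_comm es (ej j) (dd_smooth (ej j) h), dd_comm es (ej j) h]

lemma line_deriv {n : ℕ} {G : EE n × ℝ → ℂ} (h : ContDiff ℝ (⊤ : ℕ∞) G) (Z : EE n) (s : ℝ) :
    HasDerivAt (fun s => G (Z, s)) (dd es G (Z, s)) s := by
  have h1 : HasDerivAt (fun s : ℝ => ((Z, s) : EE n × ℝ)) es s :=
    (hasDerivAt_const s Z).prodMk (hasDerivAt_id s)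
  exact (smooth_diff h (Z, s)).hasFDerivAt.comp_hasDerivAt s h1

lemma hline {n : ℕ} {G : EE n × ℝ → ℂ} (v : EE n) (Z : EE n) (s : ℝ) (h0 : ∀ Z, G (Z, s) = 0)
    (h : ContDiff ℝ (⊤ : ℕ∞) G) : dd (v, 0) G (Z, s) = 0 := by
  have h1 : HasFDerivAt (fun Z : EE n => G (Z, s)) ((fderiv ℝ G (Z, s)).comp
      ((ContinuousLinearMap.id ℝ (EE n)).prod 0)) Z :=
    (smooth_diff h (Z, s)).hasFDerivAt.comp Z ((hasFDerivAt_id Z).prodMk (hasFDerivAt_const s Z))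
  have h2 : (fun Z : EE n => G (Z, s)) = fun _ => 0 := funext h0
  rw [h2] at h1
  have := congrArg (fun L => L v) (h1.unique (hasFDerivAt_const _ _))
  simpa [dd] using this

lemma main_ind {n : ℕ} (k : ℕ) : ∀ (G : EE n × ℝ → ℂ), ContDiff ℝ (⊤ : ℕ∞) G → PDE G →
    (∀ Z, G (Z, 0) = 0) → ∀ Z, iteratedDeriv k (fun s => G (Z, s)) 0 = 0 := by
  induction k with
  | zero => intro G _ _ h0 Z; simpa using h0 Z
  | succ k ih =>
    intro G h hp h0 Z
    rw [iteratedDeriv_succ']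
    have : deriv (fun s => G (Z, s)) = fun s => dd es G (Z, s) :=
      funext fun s => (line_deriv h Z s).deriv
    rw [this]
    refine ih (dd es G) (dd_smooth es h) (PDE_ds h hp) (fun Z => ?_) Z
    rw [PDE_closed h hp Z]
    rw [Finset.sum_eq_zero, mul_zero]
    intro j _
    exact hline _ Z 0 (fun Z => hline _ Z 0 h0 h) (dd_smooth _ h)

/-- ansatz in space -/
def AA {n : ℕ} (c : ℂ) (t : ℝ) (H : EE n × ℝ → ℂ) (w : EE n) : ℂ :=
  c * Complex.exp (Complex.I * ((‖w‖ ^ 2 / (4 * t) : ℝ) : ℂ)) * H ((2 * t)⁻¹ • w, 1 / t)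

lemma AA_fderiv {n : ℕ} (c : ℂ) (t : ℝ) (H : EE n × ℝ → ℂ) (h : ContDiff ℝ (⊤ : ℕ∞) H)
    (w : EE n) : ∃ L : EE n →L[ℝ] ℂ, HasFDerivAt (AA c t H) L w ∧ ∀ j,
      L (EuclideanSpace.single j (1 : ℝ)) =
        (Complex.I * (w j : ℂ) / (2 * t)) * AA c t H w + (2 * (t : ℂ))⁻¹ * AA c t (dd (ej j) H) w := by
  have h1 : HasFDerivAt (fun w : EE n => ‖w‖ ^ 2 / (4 * t)) ((4 * t)⁻¹ • ((2 : ℝ) • innerSL ℝ w)) w := by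
    have := (hasStrictFDerivAt_norm_sq w).hasFDerivAt.const_mul ((4 * t)⁻¹)
    refine this.congr_of_eventuallyEq (Filter.Eventually.of_forall fun x => ?_) |>.congr_fderiv ?_
    · simp only []; ring
    · ext; simp
  have h2 := (((Complex.ofRealCLM.hasFDerivAt.comp w h1).const_mul Complex.I).cexp).const_mul c
  have h3 : HasFDerivAt (fun w : EE n => H ((2 * t)⁻¹ • w, 1 / t))
      ((fderiv ℝ H ((2 * t)⁻¹ • w, 1 / t)).comp
      (((2 * t)⁻¹ • ContinuousLinearMap.id ℝ (EE n)).prod 0)) w :=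
    (smooth_diff h _).hasFDerivAt.comp w
      (((hasFDerivAt_id w).const_smul ((2 * t)⁻¹)).prodMk (hasFDerivAt_const (1 / t) w))
  refine ⟨_, h2.mul h3, fun j => ?_⟩
  have h4 : fderiv ℝ H ((2 * t)⁻¹ • w, 1 / t) ((2 * t)⁻¹ • EuclideanSpace.single j (1 : ℝ), 0)
      = (2 * (t : ℂ))⁻¹ * dd (ej j) H ((2 * t)⁻¹ • w, 1 / t) := by
    have : (((2 * t)⁻¹ • EuclideanSpace.single j (1 : ℝ), 0) : EE n × ℝ) = (2 * t)⁻¹ • ej j := by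
      simp [ej]
    rw [this, map_smul, Complex.real_smul]
    simp [dd]
  simp [AA, EuclideanSpace.inner_single_right] at h4 ⊢
  rw [h4]
  ring

lemma AA_lap {n : ℕ} (c : ℂ) (t : ℝ) (H : EE n × ℝ → ℂ) (h : ContDiff ℝ (⊤ : ℕ∞) H)
    (w : EE n) (j : Fin n) :
    fderiv ℝ (fun w => fderiv ℝ (AA c t H) w (EuclideanSpace.single j (1 : ℝ))) w
      (EuclideanSpace.single j (1 : ℝ)) =
    (Complex.I / (2 * t)) * AA c t H w + (Complex.I * (w j : ℂ) / (2 * t)) ^ 2 * AA c t H w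
     + 2 * (Complex.I * (w j : ℂ) / (2 * t)) * (2 * (t : ℂ))⁻¹ * AA c t (dd (ej j) H) w
     + (2 * (t : ℂ))⁻¹ ^ 2 * AA c t (dd (ej j) (dd (ej j) H)) w := by
  have e : (fun w => fderiv ℝ (AA c t H) w (EuclideanSpace.single j (1 : ℝ))) = fun w =>
      (Complex.I / (2 * t)) * ((w j : ℂ) * AA c t H w) + (2 * (t : ℂ))⁻¹ * AA c t (dd (ej j) H) w := by
    funext w
    obtain ⟨L, hL, hj⟩ := AA_fderiv c t H h w
    rw [hL.fderiv, hj]; ring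
  rw [e]
  obtain ⟨L, hL, hj⟩ := AA_fderiv c t H h w
  obtain ⟨M, hM, hk⟩ := AA_fderiv c t (dd (ej j) H) (dd_smooth _ h) w
  have hp : HasFDerivAt (fun w : EE n => ((w j : ℝ) : ℂ))
      (Complex.ofRealCLM.comp (EuclideanSpace.proj j : EE n →L[ℝ] ℝ)) w :=
    (Complex.ofRealCLM.comp (EuclideanSpace.proj j : EE n →L[ℝ] ℝ)).hasFDerivAt
  have := ((hp.mul hL).const_mul (Complex.I / (2 * t))).add (hM.const_mul ((2 * (t : ℂ))⁻¹))
  have h5 : fderiv ℝ (fun w : EE n =>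
      (Complex.I / (2 * t)) * ((w j : ℂ) * AA c t H w) + (2 * (t : ℂ))⁻¹ * AA c t (dd (ej j) H) w) w = _ :=
    this.fderiv
  rw [h5]
  simp [hj, hk]
  ring

lemma time_deriv {n : ℕ} (F : EE n × ℝ → ℂ) (h : ContDiff ℝ (⊤ : ℕ∞) F) (z : EE n) (t : ℝ)
    (ht : 0 < t) (c : ℂ) (hc : c = (4 * (Real.pi : ℂ) * Complex.I * (t : ℂ)) ^ (-(n : ℂ) / 2)) :
    HasDerivAt (fun t : ℝ => (4 * (Real.pi : ℂ) * Complex.I * (t : ℂ)) ^ (-(n : ℂ) / 2) *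
        Complex.exp (Complex.I * ((‖z‖ ^ 2 / (4 * t) : ℝ) : ℂ)) * F ((2 * t)⁻¹ • z, 1 / t))
      ((-(n : ℂ) / (2 * t)) * AA c t F z - Complex.I * (‖z‖ : ℂ) ^ 2 / (4 * t ^ 2) * AA c t F z
        - ∑ j, (z j : ℂ) / (2 * t ^ 2) * AA c t (dd (ej j) F) z
        - 1 / (t : ℂ) ^ 2 * AA c t (dd es F) z) t := by
  have ht' : (t : ℂ) ≠ 0 := by exact_mod_cast ht.ne'
  have hpi : (Real.pi : ℂ) ≠ 0 := by exact_mod_cast Real.pi_ne_zero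
  have hb : 4 * (Real.pi : ℂ) * Complex.I * (t : ℂ) ≠ 0 := by
    simp [hpi, ht', Complex.I_ne_zero]
  have h1 : HasDerivAt (fun t : ℝ => (4 * (Real.pi : ℂ) * Complex.I * (t : ℂ)) ^ (-(n : ℂ) / 2))
      ((-(n : ℂ) / (2 * t)) * c) t := by
    have a1 : HasDerivAt (fun x : ℂ => 4 * (Real.pi : ℂ) * Complex.I * x)
        (4 * (Real.pi : ℂ) * Complex.I) (t : ℂ) := by
      simpa using (hasDerivAt_id (t : ℂ)).const_mul (4 * (Real.pi : ℂ) * Complex.I)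
    have hsl : 4 * (Real.pi : ℂ) * Complex.I * (t : ℂ) ∈ Complex.slitPlane := by
      right
      simp [Real.pi_ne_zero, ht.ne']
    have a2 := (a1.cpow_const (c := -(n : ℂ) / 2) hsl).comp_ofReal
    refine a2.congr_deriv ?_
    rw [Complex.cpow_sub _ _ hb, ← hc, Complex.cpow_one]
    field_simp
  have h2r : HasDerivAt (fun t : ℝ => ‖z‖ ^ 2 / (4 * t)) (-(‖z‖ ^ 2 / (4 * t ^ 2))) t := by
    have := ((hasDerivAt_inv ht.ne').const_mul (‖z‖ ^ 2 / 4))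
    refine (this.congr_of_eventuallyEq (Filter.Eventually.of_forall fun x => ?_)).congr_deriv ?_
    · simp only []; rw [div_mul_eq_div_div]; rfl
    · field_simp
  have h2 := (h2r.ofReal_comp.const_mul Complex.I).cexp
  have h3a : HasDerivAt (fun t : ℝ => (2 * t)⁻¹ • z) ((-(1 / (2 * t ^ 2))) • z) t := by
    have := ((hasDerivAt_inv ht.ne').const_mul (2⁻¹ : ℝ))
    refine HasDerivAt.smul_const ((this.congr_of_eventuallyEq
      (Filter.Eventually.of_forall fun x => ?_)).congr_deriv ?_) z
    · simp only []; rw [mul_inv]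
    · field_simp
  have h3b : HasDerivAt (fun t : ℝ => 1 / t) (-(1 / t ^ 2)) t := by
    simpa using (hasDerivAt_inv ht.ne')
  have h3 := (smooth_diff h ((2 * t)⁻¹ • z, 1 / t)).hasFDerivAt.comp_hasDerivAt t (h3a.prodMk h3b)
  refine ((h1.mul h2).mul h3).congr_deriv ?_
  have hv : (((-(1 / (2 * t ^ 2))) • z, -(1 / t ^ 2)) : EE n × ℝ) =
      (∑ j, (-(1 / (2 * t ^ 2)) * z j) • ej j) + (-(1 / t ^ 2)) • es := by
    have hz : z = ∑ j, z j • EuclideanSpace.single j (1 : ℝ) := by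
      ext i
      simp [Finset.sum_apply, Pi.single_apply]
    refine Prod.ext ?_ ?_
    · rw [Prod.fst_add, Prod.fst_sum]
      simp only [ej, es, Prod.smul_fst, smul_zero, add_zero, mul_smul, ← Finset.smul_sum]
      rw [← hz]
    · rw [Prod.snd_add, Prod.snd_sum]
      simp [ej, es]
  have hd : fderiv ℝ F ((2 * t)⁻¹ • z, 1 / t) ((-(1 / (2 * t ^ 2))) • z, -(1 / t ^ 2)) =
      - ∑ j, (z j : ℂ) / (2 * t ^ 2) * dd (ej j) F ((2 * t)⁻¹ • z, 1 / t)
      - 1 / (t : ℂ) ^ 2 * dd es F ((2 * t)⁻¹ • z, 1 / t) := by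
    rw [hv, map_add, map_sum, map_smul, Complex.real_smul]
    rw [← Finset.sum_neg_distrib, sub_eq_add_neg]
    congr 1
    · refine Finset.sum_congr rfl fun j _ => ?_
      rw [map_smul, Complex.real_smul]
      simp only [dd]; push_cast; ring
    · simp only [dd]; push_cast; ring
  rw [hd]
  have hs : ∑ j, (z j : ℂ) / (2 * t ^ 2) * AA c t (dd (ej j) F) z =
      c * Complex.exp (Complex.I * ((‖z‖ ^ 2 / (4 * t) : ℝ) : ℂ)) *
      ∑ j, (z j : ℂ) / (2 * t ^ 2) * dd (ej j) F ((2 * t)⁻¹ • z, 1 / t) := by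
    rw [Finset.mul_sum]
    refine Finset.sum_congr rfl fun j _ => ?_
    simp only [AA]; ring
  rw [hs]
  simp only [AA, Function.comp, Pi.mul_apply, ← hc]
  push_cast
  ring

lemma to_PDE {n : ℕ} (F : EE n × ℝ → ℂ) (h : ContDiff ℝ (⊤ : ℕ∞) F) (u : EE n → ℝ → ℂ)
    (hu : ∀ z t, 0 < t → u z t =
      (4 * (Real.pi : ℂ) * Complex.I * (t : ℂ)) ^ (-(n : ℂ) / 2) *
        Complex.exp (Complex.I * ((‖z‖ ^ 2 / (4 * t) : ℝ) : ℂ)) * F ((2 * t)⁻¹ • z, 1 / t))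
    (heq : ∀ z t, 0 < t →
      (-Complex.I) * deriv (fun s => u z s) t + posLap (fun w => u w t) z = 0) : PDE F := by
  rintro ⟨Z, s⟩ hs
  simp only at hs
  obtain ⟨t, ht, rfl⟩ : ∃ t : ℝ, 0 < t ∧ s = 1 / t := ⟨1 / s, by positivity, by simp⟩
  obtain ⟨z, rfl⟩ : ∃ z : EE n, Z = (2 * t)⁻¹ • z :=
    ⟨(2 * t) • Z, by rw [smul_smul, inv_mul_cancel₀ (by positivity), one_smul]⟩
  have ht' : (t : ℂ) ≠ 0 := by exact_mod_cast ht.ne'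
  obtain ⟨c, hc⟩ : ∃ c : ℂ, c = (4 * (Real.pi : ℂ) * Complex.I * (t : ℂ)) ^ (-(n : ℂ) / 2) :=
    ⟨_, rfl⟩
  have hc0 : c ≠ 0 := by
    rw [hc]
    intro h0
    rw [Complex.cpow_eq_zero_iff] at h0
    simp [Real.pi_ne_zero, ht', Complex.I_ne_zero] at h0
  have hd := (time_deriv F h z t ht c hc).congr_of_eventuallyEq
    (f₁ := fun s => u z s) (by
      filter_upwards [Ioi_mem_nhds ht] with s hs
      exact hu z s hs)
  have hw : (fun w => u w t) = AA c t F := by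
    funext w
    rw [hu w t ht, ← hc]; rfl
  have H := heq z t ht
  rw [hd.deriv, hw] at H
  unfold posLap at H
  simp only [AA_lap c t F h z] at H
  have hn : (‖z‖ : ℂ) ^ 2 = ∑ j, (z j : ℂ) ^ 2 := by
    have := EuclideanSpace.real_norm_sq_eq z
    exact_mod_cast this
  have s1 : ∑ j, (Complex.I * (z j : ℂ) / (2 * t)) ^ 2 * AA c t F z =
      -(‖z‖ : ℂ) ^ 2 / (4 * t ^ 2) * AA c t F z := by
    rw [hn, ← Finset.sum_mul]
    congr 1
    rw [← Finset.sum_neg_distrib, Finset.sum_div]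
    refine Finset.sum_congr rfl fun j _ => ?_
    rw [div_pow, mul_pow, Complex.I_sq]; ring
  have s2 : ∑ j, 2 * (Complex.I * (z j : ℂ) / (2 * t)) * (2 * (t : ℂ))⁻¹ * AA c t (dd (ej j) F) z
      = Complex.I * ∑ j, (z j : ℂ) / (2 * t ^ 2) * AA c t (dd (ej j) F) z := by
    rw [Finset.mul_sum]
    refine Finset.sum_congr rfl fun j _ => ?_
    field_simp
  have s3 : ∑ j, (2 * (t : ℂ))⁻¹ ^ 2 * AA c t (dd (ej j) (dd (ej j) F)) z
      = (c * Complex.exp (Complex.I * ((‖z‖ ^ 2 / (4 * t) : ℝ) : ℂ))) * ((1 / (4 * (t : ℂ) ^ 2)) *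
        ∑ j, dd (ej j) (dd (ej j) F) ((2 * t)⁻¹ • z, 1 / t)) := by
    rw [Finset.mul_sum, Finset.mul_sum]
    refine Finset.sum_congr rfl fun j _ => ?_
    simp only [AA]
    field_simp
    ring
  rw [Finset.sum_add_distrib, Finset.sum_add_distrib, Finset.sum_add_distrib, s1, s2, s3,
    Finset.sum_const, Finset.card_univ, Fintype.card_fin, nsmul_eq_mul] at H
  have hE : c * Complex.exp (Complex.I * ((‖z‖ ^ 2 / (4 * t) : ℝ) : ℂ)) ≠ 0 :=
    mul_ne_zero hc0 (Complex.exp_ne_zero _)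
  have hA : AA c t (dd es F) z = (c * Complex.exp (Complex.I * ((‖z‖ ^ 2 / (4 * t) : ℝ) : ℂ))) *
    dd es F ((2 * t)⁻¹ • z, 1 / t) := rfl
  rw [hA] at H
  generalize c * Complex.exp (Complex.I * ((‖z‖ ^ 2 / (4 * t) : ℝ) : ℂ)) = E at H hE
  generalize dd es F ((2 * t)⁻¹ • z, 1 / t) = X at H ⊢
  generalize ∑ j, dd (ej j) (dd (ej j) F) ((2 * t)⁻¹ • z, 1 / t) = Y at H ⊢
  generalize ∑ j, (z j : ℂ) / (2 * t ^ 2) * AA c t (dd (ej j) F) z = S at H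
  generalize AA c t F z = A at H
  have hI := Complex.I_sq
  have H2 : E * (1 / (t : ℂ) ^ 2) * (Complex.I * X - 1 / 4 * Y) = 0 := by
    rw [← H]
    ring_nf
    rw [hI]
    ring
  have H3 : Complex.I * X - 1 / 4 * Y = 0 := by
    rcases mul_eq_zero.1 H2 with h | h
    · exact absurd h (mul_ne_zero hE (by simp [ht']))
    · exact h
  linear_combination (-Complex.I) * H3 + X * hI

lemma dd_sub {n : ℕ} (v : EE n × ℝ) {F G : EE n × ℝ → ℂ} (hF : ContDiff ℝ (⊤ : ℕ∞) F)
    (hG : ContDiff ℝ (⊤ : ℕ∞) G) : dd v (fun p => F p - G p) = fun p => dd v F p - dd v G p := by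
  funext p
  unfold dd
  rw [fderiv_fun_sub (smooth_diff hF p) (smooth_diff hG p)]
  rfl

lemma PDE_sub {n : ℕ} {F G : EE n × ℝ → ℂ} (hF : ContDiff ℝ (⊤ : ℕ∞) F)
    (hG : ContDiff ℝ (⊤ : ℕ∞) G) (h1 : PDE F) (h2 : PDE G) : PDE (fun p => F p - G p) := by
  intro p hp
  simp only [dd_sub _ hF hG, dd_sub _ (dd_smooth _ hF) (dd_smooth _ hG)]
  rw [h1 p hp, h2 p hp, Finset.sum_sub_distrib]
  ring

/-- if `u(z,t) = (4πit)^{-n/2} e^{i|z|²/(4t)} F(z/(2t), 1/t)` with `F = F(Z,s)`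
smooth, and `(D_t + Δ₀)u = 0` for `t > 0`, then the full Taylor series of `F` in `s` at
`s = 0` is determined by the asymptotic data `F(·,0)`: two such solutions with the same
data have all `s`-derivatives of `F` at `s = 0` equal (so the `F`'s differ by `O(s^∞)`). -/
theorem stmt0 (n : ℕ)
    (F₁ F₂ : EuclideanSpace ℝ (Fin n) × ℝ → ℂ)
    (hF₁ : ContDiff ℝ (⊤ : ℕ∞) F₁) (hF₂ : ContDiff ℝ (⊤ : ℕ∞) F₂)
    (u₁ u₂ : EuclideanSpace ℝ (Fin n) → ℝ → ℂ)
    (hu₁ : ∀ z t, 0 < t → u₁ z t =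
      (4 * (Real.pi : ℂ) * Complex.I * (t : ℂ)) ^ (-(n : ℂ) / 2) *
        Complex.exp (Complex.I * ((‖z‖ ^ 2 / (4 * t) : ℝ) : ℂ)) * F₁ ((2 * t)⁻¹ • z, 1 / t))
    (hu₂ : ∀ z t, 0 < t → u₂ z t =
      (4 * (Real.pi : ℂ) * Complex.I * (t : ℂ)) ^ (-(n : ℂ) / 2) *
        Complex.exp (Complex.I * ((‖z‖ ^ 2 / (4 * t) : ℝ) : ℂ)) * F₂ ((2 * t)⁻¹ • z, 1 / t))
    (heq₁ : ∀ z t, 0 < t →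
      (-Complex.I) * deriv (fun s => u₁ z s) t + posLap (fun w => u₁ w t) z = 0)
    (heq₂ : ∀ z t, 0 < t →
      (-Complex.I) * deriv (fun s => u₂ z s) t + posLap (fun w => u₂ w t) z = 0)
    (hdata : ∀ Z, F₁ (Z, 0) = F₂ (Z, 0)) :
    ∀ (k : ℕ) (Z : EuclideanSpace ℝ (Fin n)),
      iteratedDeriv k (fun s => F₁ (Z, s)) 0 = iteratedDeriv k (fun s => F₂ (Z, s)) 0 := by
  intro k Z
  have h := main_ind k (fun p => F₁ p - F₂ p) (hF₁.sub hF₂)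
    (PDE_sub hF₁ hF₂ (to_PDE F₁ hF₁ u₁ hu₁ heq₁) (to_PDE F₂ hF₂ u₂ hu₂ heq₂))
    (fun Z => by simp [hdata Z]) Z
  have g1 : ContDiff ℝ (⊤ : ℕ∞) (fun s : ℝ => F₁ (Z, s)) := hF₁.comp (by fun_prop)
  have g2 : ContDiff ℝ (⊤ : ℕ∞) (fun s : ℝ => F₂ (Z, s)) := hF₂.comp (by fun_prop)
  have hk : ((k : ℕ) : WithTop ℕ∞) ≤ ((⊤ : ℕ∞) : WithTop ℕ∞) := by exact_mod_cast le_top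
  have e := iteratedDeriv_fun_sub (x := (0 : ℝ)) (n := k) (g1.contDiffAt.of_le hk) (g2.contDiffAt.of_le hk)
  rw [e] at h
  exact sub_eq_zero.1 h
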